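/- For every X ∈ P_0(Γ), the commutant of A_X in B(H_ω) coincides with the double commutant of A_X' ∩ A, that is, A_X' = (A_X' ∩ A)'' as von Neumann algebras on H_ω. -/

import Mathlib

open scoped BigOperators
open Complex

noncomputable section

/-- A system of matrix units in a ring, indexed by a finite type. -/
structure IsMatrixUnits {n R : Type*} [Fintype n] [DecidableEq n] [Ring R]
    (e : n → n → R) : Prop where
  mul_eq : ∀ i j k l, e i j * e k l = if j = k then e i l else 0
  sum_diag : ∑ i, e i i = 1

/-- The `(i, j)` coefficient of `a` with respect to the family `e`. -/
def matrixUnitCoeff {n R : Type*} [Fintype n] [Ring R] (e : n → n → R) (i j : n) (a : R) : R :=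
  ∑ k, e k i * a * e j k

namespace IsMatrixUnits

variable {n R : Type*} [Fintype n] [DecidableEq n] [Ring R] {e : n → n → R}

theorem commute_coeff (he : IsMatrixUnits e) (p q i j : n) (a : R) :
    e p q * matrixUnitCoeff e i j a = matrixUnitCoeff e i j a * e p q := by
  have h1 : ∀ k, e p q * (e k i * a * e j k) = if q = k then e p i * a * e j k else 0 := by
    intro k
    rw [← mul_assoc, ← mul_assoc, he.mul_eq]
    split_ifs <;> simp
  have h2 : ∀ k, e k i * a * e j k * e p q = if k = p then e k i * a * e j q else 0 := by
    intro k
    rw [mul_assoc, he.mul_eq]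
    split_ifs <;> simp
  simp [matrixUnitCoeff, Finset.mul_sum, Finset.sum_mul, h1, h2]

theorem sum_mul_coeff (he : IsMatrixUnits e) (a : R) :
    ∑ i, ∑ j, e i j * matrixUnitCoeff e i j a = a := by
  have h1 : ∀ i j, e i j * matrixUnitCoeff e i j a = e i i * a * e j j := by
    intro i j
    have h2 : ∀ k, e i j * (e k i * a * e j k) = if j = k then e i i * a * e j k else 0 := by
      intro k
      rw [← mul_assoc, ← mul_assoc, he.mul_eq]
      split_ifs <;> simp
    simp [matrixUnitCoeff, Finset.mul_sum, h2]
  simp_rw [h1, ← Finset.mul_sum, he.sum_diag, mul_one, ← Finset.sum_mul, he.sum_diag, one_mul]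

end IsMatrixUnits

/-- A unital subalgebra isomorphic to a full matrix algebra is the span of a system of
matrix units. -/
theorem exists_isMatrixUnits_of_starAlgEquiv {R : Type*} [Ring R] [StarRing R] [Algebra ℂ R]
    [StarModule ℂ R] {M : StarSubalgebra ℂ R} {d : ℕ}
    (φ : M ≃⋆ₐ[ℂ] Matrix (Fin d) (Fin d) ℂ) :
    ∃ e : Fin d → Fin d → R, IsMatrixUnits e ∧ (∀ i j, e i j ∈ M) ∧
      ∀ x ∈ M, ∃ c : Fin d → Fin d → ℂ, x = ∑ i, ∑ j, c i j • e i j := by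
  refine ⟨fun i j => (φ.symm (Matrix.single i j 1) : M), ⟨?_, ?_⟩, fun i j => Subtype.prop _, ?_⟩
  · intro i j k l
    rw [← MulMemClass.coe_mul, ← map_mul]
    split_ifs with h
    · subst h
      simp
    · simp [h]
  · have h : ∑ i : Fin d, Matrix.single i i (1 : ℂ) = 1 := by
      rw [Matrix.sum_single_one]
    have h' : ∑ i : Fin d, φ.symm (Matrix.single i i (1 : ℂ)) = 1 := by
      rw [← map_sum, h, map_one]
    simpa using congrArg (Subtype.val) h'
  · intro x hx
    refine ⟨φ ⟨x, hx⟩, ?_⟩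
    have h := Matrix.matrix_eq_sum_single (φ ⟨x, hx⟩)
    have h' : (⟨x, hx⟩ : M) =
        ∑ i, ∑ j, φ ⟨x, hx⟩ i j • φ.symm (Matrix.single i j (1 : ℂ)) := by
      simp_rw [← map_smul, Matrix.smul_single, smul_eq_mul, mul_one, ← map_sum]
      rw [← h]
      exact (φ.symm_apply_apply _).symm
    simpa using congrArg (Subtype.val) h'

/-- If the commutant of `A` consists of scalars, then the relative commutant of a matrix
subalgebra `M` generates the commutant of `M`, provided that `A` contains the coefficients
of its elements with respect to the matrix units of `M`. -/
theorem centralizer_eq_of_isMatrixUnits {n R : Type*} [Fintype n] [DecidableEq n] [Ring R]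
    [Algebra ℂ R] {e : n → n → R} (he : IsMatrixUnits e) {M A : Set R}
    (heM : ∀ i j, e i j ∈ M)
    (hM : ∀ x ∈ M, ∃ c : n → n → ℂ, x = ∑ i, ∑ j, c i j • e i j)
    (hA : ∀ a ∈ A, ∀ i j, matrixUnitCoeff e i j a ∈ A)
    (hirr : ∀ T ∈ Set.centralizer A, ∃ c : ℂ, T = c • (1 : R)) :
    Set.centralizer M = Set.centralizer (Set.centralizer (Set.centralizer M ∩ A)) := by
  have hcoeff : ∀ a i j, matrixUnitCoeff e i j a ∈ Set.centralizer M := by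
    intro a i j x hx
    obtain ⟨c, rfl⟩ := hM x hx
    simp_rw [Finset.sum_mul, Finset.mul_sum, smul_mul_assoc, mul_smul_comm, he.commute_coeff]
  refine Set.Subset.antisymm ?_ ?_
  · intro T hT S hS
    have hscalar : ∀ i j, ∃ c : ℂ, matrixUnitCoeff e i j S = c • (1 : R) := by
      intro i j
      refine hirr _ fun a ha => ?_
      have hN : ∀ b ∈ Set.centralizer M ∩ A, Commute b (matrixUnitCoeff e i j S) := by
        intro b hb
        have hbe : ∀ p q, Commute b (e p q) := fun p q => (hb.1 _ (heM p q)).symm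
        have hbS : Commute b S := hS b hb
        exact Commute.sum_right _ _ _ fun k _ => ((hbe _ _).mul_right hbS).mul_right (hbe _ _)
      have : Commute a (matrixUnitCoeff e i j S) := by
        rw [← he.sum_mul_coeff a]
        refine Commute.sum_left _ _ _ fun p _ => Commute.sum_left _ _ _ fun q _ => ?_
        exact Commute.mul_left (he.commute_coeff p q i j S) (hN _ ⟨hcoeff a p q, hA a ha p q⟩)
      exact this
    have : Commute S T := by
      rw [← he.sum_mul_coeff S]
      refine Commute.sum_left _ _ _ fun i _ => Commute.sum_left _ _ _ fun j _ => ?_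
      obtain ⟨c, hc⟩ := hscalar i j
      rw [hc]
      exact Commute.mul_left (hT _ (heM i j)) ((Commute.one_left T).smul_left c)
    exact this
  · calc Set.centralizer (Set.centralizer (Set.centralizer M ∩ A))
        ⊆ Set.centralizer (Set.centralizer (Set.centralizer M)) :=
          Set.centralizer_subset (Set.centralizer_subset Set.inter_subset_left)
      _ = Set.centralizer M := Set.centralizer_centralizer_centralizer M

/-- **Lemma 2.7**: for every finite `X`, `A_X' = (A_X' ∩ A)''` on the GNS space of a
pure state (commutants taken in `B(H_ω)`, i.e. set centralizers of bounded operators). -/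
theorem statement6
    {Γ : Type*} [MetricSpace Γ] [Countable Γ]
    {Hs : Type*} [NormedAddCommGroup Hs] [InnerProductSpace ℂ Hs] [CompleteSpace Hs]
    -- the increasing net of C*-subalgebras of `B(H_ω)` (the GNS image of `A`)
    (𝒜 : Finset Γ → StarSubalgebra ℂ (Hs →L[ℂ] Hs))
    (hmono : ∀ X Y : Finset Γ, X ⊆ Y → 𝒜 X ≤ 𝒜 Y)
    -- assumption (A2): each `A_X` is *-isomorphic to a full matrix algebra
    (hA2 : ∀ X : Finset Γ, ∃ d : ℕ, 0 < d ∧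
      Nonempty ((𝒜 X) ≃⋆ₐ[ℂ] Matrix (Fin d) (Fin d) ℂ))
    -- the GNS representation of the pure state `ω` is irreducible: the commutant of
    -- `A = closure(⋃_X A_X)` consists of the scalars
    (hirr : ∀ T ∈ Set.centralizer
        (closure (⋃ X : Finset Γ, (𝒜 X : Set (Hs →L[ℂ] Hs)))),
      ∃ c : ℂ, T = c • (1 : Hs →L[ℂ] Hs)) :
    -- conclusion: `A_X' = (A_X' ∩ A)''` in `B(H_ω)`
    ∀ X : Finset Γ,
      Set.centralizer (𝒜 X : Set (Hs →L[ℂ] Hs)) =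
        Set.centralizer (Set.centralizer
          (Set.centralizer (𝒜 X : Set (Hs →L[ℂ] Hs)) ∩
            closure (⋃ Y : Finset Γ, (𝒜 Y : Set (Hs →L[ℂ] Hs))))) := by
  classical
  intro X
  obtain ⟨d, -, ⟨φ⟩⟩ := hA2 X
  obtain ⟨e, he, heM, hM⟩ := exists_isMatrixUnits_of_starAlgEquiv φ
  refine centralizer_eq_of_isMatrixUnits he heM hM (fun a ha i j => ?_) hirr
  have hcont : Continuous (matrixUnitCoeff e i j) := by
    unfold matrixUnitCoeff
    fun_prop
  refine map_mem_closure hcont ha fun b hb => ?_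
  obtain ⟨Y, hY⟩ := Set.mem_iUnion.1 hb
  refine Set.mem_iUnion.2 ⟨X ∪ Y, ?_⟩
  have he' : ∀ p q, e p q ∈ 𝒜 (X ∪ Y) := fun p q =>
    hmono _ _ Finset.subset_union_left (heM p q)
  have hb' : b ∈ 𝒜 (X ∪ Y) := hmono _ _ Finset.subset_union_right hY
  exact sum_mem fun k _ => mul_mem (mul_mem (he' k i) hb') (he' j k)

end
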